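/- For any Lie superalgebra L over a field F (char F ≠ 2,3), the sequence 0 → M(L) → L ∧ L → L' → 0 is a central extension, where M(L) is the Schur multiplier, L ∧ L is the exterior square, the map L ∧ L → L' sends x ∧ y to [x,y], and the image of M(L) is contained in the center of L ∧ L. -/

import Mathlib

/-!
Common definitions: Lie superalgebras over a field `F` (char ≠ 2,3 where needed),
graded ideals, centers, capability, epicenter, non-abelian tensor and exterior
products (characterized by generators-and-relations universal properties),
free Lie superalgebras, Schur multipliers, Heisenberg Lie superalgebras, etc.
-/

namespace SuperLie

open Submodule Function Module

universe u v w

/-- The sign `(-1)^{|a||b|}` attached to a pair of `ℤ₂`-degrees. -/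
def sg (F : Type u) [Field F] (a b : ZMod 2) : F := (-1 : F) ^ (a.val * b.val)

/-- A Lie superalgebra over `F`: a `ℤ₂`-graded vector space `L = L₀ ⊕ L₁`
together with an even bilinear bracket satisfying graded skew-symmetry and the
graded Jacobi identity (on homogeneous elements). -/
class LieSuper (F : Type u) [Field F] (L : Type v) [AddCommGroup L] [Module F L] where
  gr : ZMod 2 → Submodule F L
  isCompl_gr : IsCompl (gr 0) (gr 1)
  br : L → L → L
  br_add_left : ∀ x y z : L, br (x + y) z = br x z + br y z
  br_add_right : ∀ x y z : L, br x (y + z) = br x y + br x z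
  br_smul_left : ∀ (c : F) (x y : L), br (c • x) y = c • br x y
  br_smul_right : ∀ (c : F) (x y : L), br x (c • y) = c • br x y
  br_gr : ∀ a b : ZMod 2, ∀ x ∈ gr a, ∀ y ∈ gr b, br x y ∈ gr (a + b)
  br_skew : ∀ a b : ZMod 2, ∀ x ∈ gr a, ∀ y ∈ gr b, br x y = -(sg F a b) • br y x
  br_jacobi : ∀ a b c : ZMod 2, ∀ x ∈ gr a, ∀ y ∈ gr b, ∀ z ∈ gr c,
    sg F a c • br x (br y z) + sg F b a • br y (br z x) + sg F c b • br z (br x y) = 0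

/-- The `a`-graded piece of a Lie superalgebra. -/
def grd (F : Type u) [Field F] (L : Type v) [AddCommGroup L] [Module F L] [LieSuper F L]
    (a : ZMod 2) : Submodule F L :=
  LieSuper.gr a

/-- The bracket of a Lie superalgebra. -/
def sbr (F : Type u) [Field F] {L : Type v} [AddCommGroup L] [Module F L] [LieSuper F L]
    (x y : L) : L :=
  LieSuper.br (F := F) x y

/-- The center `Z(L) = {z ∈ L : [z,x] = 0 for all x ∈ L}`. -/
def centerS (F : Type u) [Field F] (L : Type v) [AddCommGroup L] [Module F L] [LieSuper F L] :
    Submodule F L where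
  carrier := {z : L | ∀ x : L, sbr F z x = 0}
  add_mem' := by
    intro a b ha hb x
    simp only [Set.mem_setOf_eq, sbr] at ha hb ⊢
    rw [LieSuper.br_add_left, ha x, hb x, add_zero]
  zero_mem' := by
    intro x
    have h := LieSuper.br_smul_left (F := F) (0 : F) (0 : L) x
    simp only [Set.mem_setOf_eq, sbr, zero_smul] at h ⊢
    simpa using h
  smul_mem' := by
    intro c a ha x
    simp only [Set.mem_setOf_eq, sbr] at ha ⊢
    rw [LieSuper.br_smul_left, ha x, smul_zero]

/-- Homomorphisms of Lie superalgebras: even (grading preserving) linear maps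
which preserve the bracket. -/
def IsHom (F : Type u) [Field F] {L : Type v} {M : Type w}
    [AddCommGroup L] [Module F L] [LieSuper F L]
    [AddCommGroup M] [Module F M] [LieSuper F M] (f : L →ₗ[F] M) : Prop :=
  (∀ a : ZMod 2, ∀ x ∈ grd F L a, f x ∈ grd F M a) ∧
  (∀ x y : L, f (sbr F x y) = sbr F (f x) (f y))

/-- A bundled Lie superalgebra over `F`. -/
structure LieSupAlg (F : Type u) [Field F] : Type (max u (v + 1)) where
  carrier : Type v
  [iag : AddCommGroup carrier]
  [imo : Module F carrier]
  [ils : LieSuper F carrier]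

attribute [instance] LieSupAlg.iag LieSupAlg.imo LieSupAlg.ils

instance (F : Type u) [Field F] : CoeSort (LieSupAlg.{u, v} F) (Type v) :=
  ⟨LieSupAlg.carrier⟩

/-- A Lie superalgebra `L` is capable if `L ≅ H/Z(H)` for some Lie superalgebra `H`,
i.e. there is a surjective homomorphism onto `L` whose kernel is exactly the center. -/
def Capable (F : Type u) [Field F] (L : Type v) [AddCommGroup L] [Module F L]
    [LieSuper F L] : Prop :=
  ∃ (H : LieSupAlg.{u, max u v} F) (φ : H.carrier →ₗ[F] L),
    IsHom F φ ∧ Surjective φ ∧ LinearMap.ker φ = centerS F H.carrier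

/-- Graded ideals of a Lie superalgebra. -/
def IsGIdeal (F : Type u) [Field F] {L : Type v} [AddCommGroup L] [Module F L]
    [LieSuper F L] (I : Submodule F L) : Prop :=
  (∀ x ∈ I, ∀ y : L, sbr F x y ∈ I) ∧ (∀ y : L, ∀ x ∈ I, sbr F y x ∈ I) ∧
  (∀ x ∈ I, ∃ x0 ∈ I ⊓ grd F L 0, ∃ x1 ∈ I ⊓ grd F L 1, x = x0 + x1)

/-- The graded ideal generated by a subset. -/
def idealClosure (F : Type u) [Field F] {L : Type v} [AddCommGroup L] [Module F L]
    [LieSuper F L] (S : Set L) : Submodule F L :=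
  sInf {I : Submodule F L | IsGIdeal F I ∧ S ⊆ ↑I}

/-- `QuotCapable F L N` expresses that the quotient Lie superalgebra `L/N` is capable. -/
def QuotCapable (F : Type u) [Field F] (L : Type v) [AddCommGroup L] [Module F L]
    [LieSuper F L] (N : Submodule F L) : Prop :=
  ∃ (Q : LieSupAlg.{u, max u v} F) (π : L →ₗ[F] Q.carrier),
    IsHom F π ∧ Surjective π ∧ LinearMap.ker π = N ∧ Capable F Q.carrier

/-- The epicenter `Z^*(L)`: the smallest graded ideal of `L` such that the
corresponding quotient is capable. -/
def IsEpicenter (F : Type u) [Field F] (L : Type v) [AddCommGroup L] [Module F L]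
    [LieSuper F L] (Z : Submodule F L) : Prop :=
  IsGIdeal F Z ∧ QuotCapable F L Z ∧
  ∀ N : Submodule F L, IsGIdeal F N → QuotCapable F L N → Z ≤ N

/-- The submodule `[I,J]` spanned by brackets. -/
def bracketSpan (F : Type u) [Field F] {L : Type v} [AddCommGroup L] [Module F L]
    [LieSuper F L] (I J : Submodule F L) : Submodule F L :=
  Submodule.span F {z : L | ∃ x ∈ I, ∃ y ∈ J, z = sbr F x y}

/-- The derived subalgebra `L' = [L,L]`. -/
def derived (F : Type u) [Field F] (L : Type v) [AddCommGroup L] [Module F L]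
    [LieSuper F L] : Submodule F L :=
  bracketSpan F (⊤ : Submodule F L) ⊤

/-- The lower central series of a Lie superalgebra. -/
def lowerCentral (F : Type u) [Field F] (L : Type v) [AddCommGroup L] [Module F L]
    [LieSuper F L] : ℕ → Submodule F L
  | 0 => ⊤
  | n + 1 => bracketSpan F (lowerCentral F L n) ⊤

/-- A Lie superalgebra is nilpotent if its lower central series terminates at zero. -/
def IsNilp (F : Type u) [Field F] (L : Type v) [AddCommGroup L] [Module F L]
    [LieSuper F L] : Prop :=
  ∃ n : ℕ, lowerCentral F L n = ⊥

/-- An action of a Lie superalgebra `P` on a Lie superalgebra `M`: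
an even bilinear map satisfying the two action axioms. -/
structure IsAction (F : Type u) [Field F] {P : Type v} {M : Type v}
    [AddCommGroup P] [Module F P] [LieSuper F P]
    [AddCommGroup M] [Module F M] [LieSuper F M] (act : P → M → M) : Prop where
  add_left : ∀ (p q : P) (m : M), act (p + q) m = act p m + act q m
  add_right : ∀ (p : P) (m m' : M), act p (m + m') = act p m + act p m'
  smul_left : ∀ (c : F) (p : P) (m : M), act (c • p) m = c • act p m
  smul_right : ∀ (c : F) (p : P) (m : M), act p (c • m) = c • act p m
  grade : ∀ a b : ZMod 2, ∀ p ∈ grd F P a, ∀ m ∈ grd F M b, act p m ∈ grd F M (a + b)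
  br_act : ∀ a b : ZMod 2, ∀ p ∈ grd F P a, ∀ p' ∈ grd F P b, ∀ m : M,
    act (sbr F p p') m = act p (act p' m) - sg F a b • act p' (act p m)
  act_br : ∀ a b : ZMod 2, ∀ p ∈ grd F P a, ∀ m ∈ grd F M b, ∀ m' : M,
    act p (sbr F m m') = sbr F (act p m) m' + sg F a b • sbr F m (act p m')

/-- Compatibility of mutual actions of two Lie superalgebras on each other. -/
def Compatible (F : Type u) [Field F] {M : Type v} {N : Type v}
    [AddCommGroup M] [Module F M] [LieSuper F M]
    [AddCommGroup N] [Module F N] [LieSuper F N]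
    (actMN : M → N → N) (actNM : N → M → M) : Prop :=
  (∀ a b : ZMod 2, ∀ m ∈ grd F M a, ∀ n ∈ grd F N b, ∀ n' : N,
      actMN (actNM n m) n' = -(sg F a b) • sbr F (actMN m n) n') ∧
  (∀ a b : ZMod 2, ∀ m ∈ grd F M a, ∀ n ∈ grd F N b, ∀ m' : M,
      actNM (actMN m n) m' = -(sg F a b) • sbr F (actNM n m) m')

/-- The defining relations of the non-abelian tensor product `M ⊗ N` of Lie
superalgebras (with given mutual actions), satisfied by a pairing `q` into `T`. -/
structure TensorRel (F : Type u) [Field F] {M : Type v} {N : Type v} {T : Type w}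
    [AddCommGroup M] [Module F M] [LieSuper F M]
    [AddCommGroup N] [Module F N] [LieSuper F N]
    [AddCommGroup T] [Module F T] [LieSuper F T]
    (actMN : M → N → N) (actNM : N → M → M) (q : M → N → T) : Prop where
  add_left : ∀ (m m' : M) (n : N), q (m + m') n = q m n + q m' n
  add_right : ∀ (m : M) (n n' : N), q m (n + n') = q m n + q m n'
  smul_left : ∀ (c : F) (m : M) (n : N), q (c • m) n = c • q m n
  smul_right : ∀ (c : F) (m : M) (n : N), q m (c • n) = c • q m n
  grade : ∀ a b : ZMod 2, ∀ m ∈ grd F M a, ∀ n ∈ grd F N b, q m n ∈ grd F T (a + b)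
  brk_left : ∀ a b : ZMod 2, ∀ m ∈ grd F M a, ∀ m' ∈ grd F M b, ∀ n : N,
    q (sbr F m m') n = q m (actMN m' n) - sg F a b • q m' (actMN m n)
  brk_right : ∀ a b c : ZMod 2, ∀ m ∈ grd F M a, ∀ n ∈ grd F N b, ∀ n' ∈ grd F N c,
    q m (sbr F n n') = sg F c (a + b) • q (actNM n' m) n - sg F a b • q (actNM n m) n'
  brk_brk : ∀ a b : ZMod 2, ∀ m ∈ grd F M a, ∀ n ∈ grd F N b, ∀ (m' : M) (n' : N),
    sbr F (q m n) (q m' n') = -(sg F a b) • q (actNM n m) (actMN m' n')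

/-- `IsTensorObj F actMN actNM t` says that `(T, t)` is the non-abelian tensor
product `M ⊗ N`: the pairing `t` satisfies the defining relations and is
universal among all pairings satisfying them. -/
structure IsTensorObj (F : Type u) [Field F] {M : Type v} {N : Type v} {T : Type v}
    [AddCommGroup M] [Module F M] [LieSuper F M]
    [AddCommGroup N] [Module F N] [LieSuper F N]
    [AddCommGroup T] [Module F T] [LieSuper F T]
    (actMN : M → N → N) (actNM : N → M → M) (t : M → N → T) : Prop where
  rel : TensorRel F actMN actNM t
  lift : ∀ (Q : LieSupAlg.{u, max u v} F) (q : M → N → Q.carrier),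
    TensorRel F actMN actNM q →
    ∃! h : T →ₗ[F] Q.carrier, IsHom F h ∧ ∀ (m : M) (n : N), h (t m n) = q m n

/-- The defining relations of the non-abelian exterior square `L ∧ L` of a Lie
superalgebra (the tensor relations for the bracket actions, together with the
graded alternating relations coming from `L □ L`). -/
structure ExtRel (F : Type u) [Field F] {L : Type v} {T : Type w}
    [AddCommGroup L] [Module F L] [LieSuper F L]
    [AddCommGroup T] [Module F T] [LieSuper F T] (q : L → L → T) : Prop where
  toTensor : TensorRel F (fun x y : L => sbr F x y) (fun x y : L => sbr F x y) q
  alt : ∀ a b : ZMod 2, ∀ x ∈ grd F L a, ∀ y ∈ grd F L b, q x y = -(sg F a b) • q y x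
  alt_even : ∀ x ∈ grd F L 0, q x x = 0

/-- `IsExtObj F t` says that `(E, t)` is the non-abelian exterior square `L ∧ L`. -/
structure IsExtObj (F : Type u) [Field F] {L : Type v} {E : Type v}
    [AddCommGroup L] [Module F L] [LieSuper F L]
    [AddCommGroup E] [Module F E] [LieSuper F E] (t : L → L → E) : Prop where
  rel : ExtRel F t
  lift : ∀ (Q : LieSupAlg.{u, max u v} F) (q : L → L → Q.carrier),
    ExtRel F q →
    ∃! h : E →ₗ[F] Q.carrier, IsHom F h ∧ ∀ x y : L, h (t x y) = q x y

/-- A free Lie superalgebra: free on some `ℤ₂`-graded subset `X`. -/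
def IsFreeLieSuper (F : Type u) [Field F] (Fr : Type v) [AddCommGroup Fr] [Module F Fr]
    [LieSuper F Fr] : Prop :=
  ∃ X : ZMod 2 → Set Fr,
    (∀ a : ZMod 2, X a ⊆ (grd F Fr a : Set Fr)) ∧
    ∀ (Q : LieSupAlg.{u, max u v} F) (f : ∀ a : ZMod 2, X a → Q.carrier),
      (∀ (a : ZMod 2) (x : X a), f a x ∈ grd F Q.carrier a) →
      ∃! h : Fr →ₗ[F] Q.carrier,
        IsHom F h ∧ ∀ (a : ZMod 2) (x : X a), h (x : Fr) = f a x

/-- `F' ∩ R`, for a free presentation with kernel `R`. -/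
abbrev schurA (F : Type u) [Field F] (Fr : Type v) [AddCommGroup Fr] [Module F Fr]
    [LieSuper F Fr] (R : Submodule F Fr) : Submodule F Fr :=
  derived F Fr ⊓ R

/-- The Schur multiplier `M(L) = (F' ∩ R)/[R,F]` attached to a free presentation
`0 → R → F → L → 0`. -/
abbrev SchurMul (F : Type u) [Field F] (Fr : Type v) [AddCommGroup Fr] [Module F Fr]
    [LieSuper F Fr] (R : Submodule F Fr) :=
  ↥(schurA F Fr R) ⧸ (Submodule.comap (schurA F Fr R).subtype (bracketSpan F R ⊤))

/-- `L` is (isomorphic to) the special Heisenberg Lie superalgebra `H(m,n)` with even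
center: basis `x₁,…,x_{2m}, z` (even), `y₁,…,y_n` (odd), with `[xᵢ, x_{m+i}] = z`,
`[y_j, y_j] = z` and `z` central. -/
def IsHeisE (F : Type u) [Field F] (m n : ℕ) (L : Type v) [AddCommGroup L] [Module F L]
    [LieSuper F L] : Prop :=
  ∃ (x : Fin (2 * m) → L) (y : Fin n → L) (z : L),
    (∀ i, x i ∈ grd F L 0) ∧ z ∈ grd F L 0 ∧ (∀ j, y j ∈ grd F L 1) ∧
    LinearIndependent F (Sum.elim x (Sum.elim y (fun _ : Unit => z))) ∧
    Submodule.span F (Set.range (Sum.elim x (Sum.elim y (fun _ : Unit => z)))) = ⊤ ∧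
    (∀ i j : Fin (2 * m), sbr F (x i) (x j) =
      if (j : ℕ) = (i : ℕ) + m then z else if (i : ℕ) = (j : ℕ) + m then -z else 0) ∧
    (∀ (i : Fin (2 * m)) (j : Fin n), sbr F (x i) (y j) = 0) ∧
    (∀ (i : Fin (2 * m)) (j : Fin n), sbr F (y j) (x i) = 0) ∧
    (∀ i j : Fin n, sbr F (y i) (y j) = if i = j then z else 0) ∧
    (∀ w : L, sbr F z w = 0) ∧ (∀ w : L, sbr F w z = 0)

/-- `L` is (isomorphic to) the Heisenberg Lie superalgebra `H_m` with odd center: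
basis `x₁,…,x_m` (even), `y₁,…,y_m, z` (odd), with `[x_j, y_j] = z` and `z` central. -/
def IsHeisO (F : Type u) [Field F] (m : ℕ) (L : Type v) [AddCommGroup L] [Module F L]
    [LieSuper F L] : Prop :=
  ∃ (x : Fin m → L) (y : Fin m → L) (z : L),
    (∀ i, x i ∈ grd F L 0) ∧ (∀ j, y j ∈ grd F L 1) ∧ z ∈ grd F L 1 ∧
    LinearIndependent F (Sum.elim x (Sum.elim y (fun _ : Unit => z))) ∧
    Submodule.span F (Set.range (Sum.elim x (Sum.elim y (fun _ : Unit => z)))) = ⊤ ∧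
    (∀ i j : Fin m, sbr F (x i) (x j) = 0) ∧
    (∀ i j : Fin m, sbr F (x i) (y j) = if i = j then z else 0) ∧
    (∀ i j : Fin m, sbr F (y j) (x i) = if i = j then -z else 0) ∧
    (∀ i j : Fin m, sbr F (y i) (y j) = 0) ∧
    (∀ w : L, sbr F z w = 0) ∧ (∀ w : L, sbr F w z = 0)

/-- `A` is (isomorphic to) the abelian Lie superalgebra `A(r | s)` of
superdimension `(r | s)`. -/
def IsAbelSuper (F : Type u) [Field F] (r s : ℕ) (A : Type v) [AddCommGroup A]
    [Module F A] [LieSuper F A] : Prop :=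
  (∀ x y : A, sbr F x y = 0) ∧ Module.Finite F A ∧
  Module.finrank F ↥(grd F A 0) = r ∧ Module.finrank F ↥(grd F A 1) = s

/-- The direct sum (product) of two Lie superalgebras. -/
instance prodLieSuper (F : Type u) [Field F] (A : Type v) (B : Type w)
    [AddCommGroup A] [Module F A] [LieSuper F A]
    [AddCommGroup B] [Module F B] [LieSuper F B] : LieSuper F (A × B) where
  gr a := (grd F A a).prod (grd F B a)
  isCompl_gr := by
    have hA : IsCompl (grd F A 0) (grd F A 1) := LieSuper.isCompl_gr
    have hB : IsCompl (grd F B 0) (grd F B 1) := LieSuper.isCompl_gr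
    constructor
    · rw [disjoint_iff, eq_bot_iff]
      rintro ⟨a, b⟩ h
      rw [Submodule.mem_inf] at h
      obtain ⟨h0, h1⟩ := h
      rw [Submodule.mem_prod] at h0 h1
      have ha : a = 0 := by
        have := hA.disjoint.le_bot (Submodule.mem_inf.mpr ⟨h0.1, h1.1⟩)
        simpa using this
      have hb : b = 0 := by
        have := hB.disjoint.le_bot (Submodule.mem_inf.mpr ⟨h0.2, h1.2⟩)
        simpa using this
      simp [ha, hb, Prod.ext_iff]
    · rw [codisjoint_iff, eq_top_iff]
      rintro ⟨a, b⟩ -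
      have ha' : a ∈ grd F A 0 ⊔ grd F A 1 := by
        rw [hA.codisjoint.eq_top]; trivial
      have hb' : b ∈ grd F B 0 ⊔ grd F B 1 := by
        rw [hB.codisjoint.eq_top]; trivial
      obtain ⟨a0, ha0, a1, ha1, rfl⟩ := Submodule.mem_sup.mp ha'
      obtain ⟨b0, hb0, b1, hb1, rfl⟩ := Submodule.mem_sup.mp hb'
      refine Submodule.mem_sup.mpr ⟨(a0, b0), ?_, (a1, b1), ?_, ?_⟩
      · exact Submodule.mem_prod.mpr ⟨ha0, hb0⟩
      · exact Submodule.mem_prod.mpr ⟨ha1, hb1⟩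
      · rfl
  br x y := (sbr F x.1 y.1, sbr F x.2 y.2)
  br_add_left := by
    intro x y z
    simp only [Prod.fst_add, Prod.snd_add, sbr, LieSuper.br_add_left]
    rfl
  br_add_right := by
    intro x y z
    simp only [Prod.fst_add, Prod.snd_add, sbr, LieSuper.br_add_right]
    rfl
  br_smul_left := by
    intro c x y
    simp only [Prod.smul_fst, Prod.smul_snd, sbr, LieSuper.br_smul_left]
    rfl
  br_smul_right := by
    intro c x y
    simp only [Prod.smul_fst, Prod.smul_snd, sbr, LieSuper.br_smul_right]
    rfl
  br_gr := by
    intro a b x hx y hy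
    rw [Submodule.mem_prod] at hx hy ⊢
    exact ⟨LieSuper.br_gr a b x.1 hx.1 y.1 hy.1, LieSuper.br_gr a b x.2 hx.2 y.2 hy.2⟩
  br_skew := by
    intro a b x hx y hy
    rw [Submodule.mem_prod] at hx hy
    have h1 := LieSuper.br_skew (F := F) a b x.1 hx.1 y.1 hy.1
    have h2 := LieSuper.br_skew (F := F) a b x.2 hx.2 y.2 hy.2
    simp only [sbr]
    rw [Prod.ext_iff]
    exact ⟨h1, h2⟩
  br_jacobi := by
    intro a b c x hx y hy z hz
    rw [Submodule.mem_prod] at hx hy hz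
    have h1 := LieSuper.br_jacobi (F := F) a b c x.1 hx.1 y.1 hy.1 z.1 hz.1
    have h2 := LieSuper.br_jacobi (F := F) a b c x.2 hx.2 y.2 hy.2 z.2 hz.2
    simp only [sbr]
    rw [Prod.ext_iff]
    exact ⟨h1, h2⟩

section Helpers

theorem zmod2_cases (a : ZMod 2) : a = 0 ∨ a = 1 := by
  revert a; decide

theorem sg_zero_left (F : Type u) [Field F] (b : ZMod 2) : sg F 0 b = 1 := by simp [sg]

theorem sg_zero_right (F : Type u) [Field F] (b : ZMod 2) : sg F b 0 = 1 := by simp [sg]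

theorem sg_one_one (F : Type u) [Field F] : sg F 1 1 = -1 := by
  have : (1 : ZMod 2).val = 1 := rfl
  simp [sg, this]

theorem zmod2_one_add_one : (1 : ZMod 2) + 1 = 0 := by decide

section basic
variable {F : Type u} [Field F] {L : Type v} [AddCommGroup L] [Module F L] [LieSuper F L]

theorem sbr_add_left (x y z : L) : sbr F (x + y) z = sbr F x z + sbr F y z :=
  LieSuper.br_add_left x y z
theorem sbr_add_right (x y z : L) : sbr F x (y + z) = sbr F x y + sbr F x z :=
  LieSuper.br_add_right x y z
theorem sbr_smul_left (c : F) (x y : L) : sbr F (c • x) y = c • sbr F x y :=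
  LieSuper.br_smul_left c x y
theorem sbr_smul_right (c : F) (x y : L) : sbr F x (c • y) = c • sbr F x y :=
  LieSuper.br_smul_right c x y
theorem sbr_zero_left (x : L) : sbr F 0 x = 0 := by
  simpa using sbr_smul_left (0 : F) (0 : L) x
theorem sbr_zero_right (x : L) : sbr F x 0 = 0 := by
  simpa using sbr_smul_right (0 : F) x (0 : L)
theorem sbr_neg_left (x y : L) : sbr F (-x) y = - sbr F x y := by
  simpa using sbr_smul_left (-1 : F) x y
theorem sbr_neg_right (x y : L) : sbr F x (-y) = - sbr F x y := by
  simpa using sbr_smul_right (-1 : F) x y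
theorem sbr_sub_left (x y z : L) : sbr F (x - y) z = sbr F x z - sbr F y z := by
  rw [sub_eq_add_neg, sbr_add_left, sbr_neg_left, sub_eq_add_neg]
theorem sbr_sub_right (x y z : L) : sbr F x (y - z) = sbr F x y - sbr F x z := by
  rw [sub_eq_add_neg, sbr_add_right, sbr_neg_right, sub_eq_add_neg]
theorem sbr_gr {a b : ZMod 2} {x y : L} (hx : x ∈ grd F L a) (hy : y ∈ grd F L b) :
    sbr F x y ∈ grd F L (a + b) := LieSuper.br_gr a b x hx y hy
theorem sbr_skew {a b : ZMod 2} {x y : L} (hx : x ∈ grd F L a) (hy : y ∈ grd F L b) :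
    sbr F x y = -(sg F a b) • sbr F y x := LieSuper.br_skew a b x hx y hy
theorem sbr_jacobi {a b c : ZMod 2} {x y z : L} (hx : x ∈ grd F L a) (hy : y ∈ grd F L b)
    (hz : z ∈ grd F L c) :
    sg F a c • sbr F x (sbr F y z) + sg F b a • sbr F y (sbr F z x)
      + sg F c b • sbr F z (sbr F x y) = 0 := LieSuper.br_jacobi a b c x hx y hy z hz

variable (F) in
theorem exists_dec (x : L) : ∃ x0 ∈ grd F L 0, ∃ x1 ∈ grd F L 1, x = x0 + x1 := by
  have h : IsCompl (grd F L 0) (grd F L 1) := LieSuper.isCompl_gr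
  have hx : x ∈ grd F L 0 ⊔ grd F L 1 := by rw [h.codisjoint.eq_top]; trivial
  obtain ⟨a0, ha0, a1, ha1, h⟩ := Submodule.mem_sup.mp hx
  exact ⟨a0, ha0, a1, ha1, h.symm⟩

theorem gr_disj {x : L} (h0 : x ∈ grd F L 0) (h1 : x ∈ grd F L 1) : x = 0 := by
  have h : IsCompl (grd F L 0) (grd F L 1) := LieSuper.isCompl_gr
  simpa using h.disjoint.le_bot (Submodule.mem_inf.mpr ⟨h0, h1⟩)

theorem dec_unique {x0 x1 y0 y1 : L} (hx0 : x0 ∈ grd F L 0) (hx1 : x1 ∈ grd F L 1)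
    (hy0 : y0 ∈ grd F L 0) (hy1 : y1 ∈ grd F L 1) (h : x0 + x1 = y0 + y1) :
    x0 = y0 ∧ x1 = y1 := by
  have h2 : x0 - y0 = y1 - x1 := by
    rw [sub_eq_sub_iff_add_eq_add, h, add_comm]
  have h3 : x0 - y0 = 0 := gr_disj (F := F) (sub_mem hx0 hy0) (h2 ▸ sub_mem hy1 hx1)
  have h4 : x0 = y0 := sub_eq_zero.mp h3
  subst h4
  exact ⟨rfl, add_left_cancel h⟩

theorem jac_left {a b c : ZMod 2} {x y z : L} (hx : x ∈ grd F L a) (hy : y ∈ grd F L b)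
    (hz : z ∈ grd F L c) :
    sbr F (sbr F x y) z = sbr F x (sbr F y z) - sg F a b • sbr F y (sbr F x z) := by
  have h1 := sbr_jacobi hx hy hz
  rw [sbr_skew hz hx, sbr_skew hz (sbr_gr hx hy), sbr_smul_right] at h1
  rcases zmod2_cases a with rfl | rfl <;> rcases zmod2_cases b with rfl | rfl <;>
    rcases zmod2_cases c with rfl | rfl <;>
    simp only [sg_zero_left, sg_zero_right, sg_one_one, zmod2_one_add_one, add_zero, zero_add]
      at h1 ⊢ <;>
    first
    | (rw [← sub_eq_zero]; rw [← h1]; module)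
    | (rw [← sub_eq_zero]; rw [← neg_eq_zero, ← h1]; module)

theorem jac_left' {a b : ZMod 2} {x y : L} (hx : x ∈ grd F L a) (hy : y ∈ grd F L b) (z : L) :
    sbr F (sbr F x y) z = sbr F x (sbr F y z) - sg F a b • sbr F y (sbr F x z) := by
  obtain ⟨z0, hz0, z1, hz1, rfl⟩ := exists_dec F z
  simp only [sbr_add_right, jac_left hx hy hz0, jac_left hx hy hz1]
  module

theorem jac_right {a b c : ZMod 2} {x y z : L} (hx : x ∈ grd F L a) (hy : y ∈ grd F L b)
    (hz : z ∈ grd F L c) :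
    sbr F x (sbr F y z) = sg F c (a + b) • sbr F (sbr F z x) y - sg F a b • sbr F (sbr F y x) z := by
  rw [jac_left hz hx hy, jac_left hy hx hz, sbr_skew hz hy, sbr_skew hz (sbr_gr hx hy),
    jac_left hx hy hz, sbr_smul_right]
  rcases zmod2_cases a with rfl | rfl <;> rcases zmod2_cases b with rfl | rfl <;>
    rcases zmod2_cases c with rfl | rfl <;>
    simp only [sg_zero_left, sg_zero_right, sg_one_one, zmod2_one_add_one, add_zero, zero_add] <;>
    module

theorem extRel_sbr (h2 : (2 : F) ≠ 0) : ExtRel F (fun x y : L => sbr F x y) where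
  toTensor :=
    { add_left := sbr_add_left
      add_right := sbr_add_right
      smul_left := sbr_smul_left
      smul_right := sbr_smul_right
      grade := fun a b m hm n hn => sbr_gr hm hn
      brk_left := fun a b m hm m' hm' n => jac_left' hm hm' n
      brk_right := fun a b c m hm n hn n' hn' => jac_right hm hn hn'
      brk_brk := fun a b m hm n hn m' n' => by
        change sbr F (sbr F m n) (sbr F m' n') = -(sg F a b) • sbr F (sbr F n m) (sbr F m' n')
        rw [sbr_skew hm hn, sbr_smul_left] }
  alt := fun a b x hx y hy => sbr_skew hx hy
  alt_even := fun x hx => by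
    have h := sbr_skew hx hx
    rw [sg_zero_left] at h
    have h3 : (2 : F) • sbr F x x = 0 := by
      nth_rewrite 1 [← sub_eq_zero] at h
      rw [← h]; module
    exact (smul_eq_zero.mp h3).resolve_left h2

end basic

/-- Lie superalgebra structure induced along an injective linear map whose range
is a graded subalgebra. -/
@[reducible] noncomputable def indInj {F : Type u} [Field F] {L : Type v} [AddCommGroup L] [Module F L]
    [LieSuper F L] {A : Type w} [AddCommGroup A] [Module F A] (f : A →ₗ[F] L)
    (hf : Injective f) (hb : ∀ x y : A, ∃ z : A, f z = sbr F (f x) (f y))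
    (hg : ∀ x : A, ∃ x0 x1 : A, f x0 ∈ grd F L 0 ∧ f x1 ∈ grd F L 1 ∧ x = x0 + x1) :
    LieSuper F A :=
  let B : A → A → A := fun x y => (hb x y).choose
  have hB : ∀ x y, f (B x y) = sbr F (f x) (f y) := fun x y => (hb x y).choose_spec
  {
  gr a := (grd F L a).comap f
  isCompl_gr := by
    constructor
    · rw [disjoint_iff, eq_bot_iff]
      rintro x h
      obtain ⟨h0, h1⟩ := Submodule.mem_inf.mp h
      exact hf (by simpa using gr_disj (F := F) h0 h1)
    · rw [codisjoint_iff, eq_top_iff]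
      rintro x -
      obtain ⟨x0, x1, h0, h1, rfl⟩ := hg x
      exact Submodule.mem_sup.mpr ⟨x0, h0, x1, h1, rfl⟩
  br := B
  br_add_left x y z := hf (by
    simp only [map_add, hB, sbr_add_left])
  br_add_right x y z := hf (by
    simp only [map_add, hB, sbr_add_right])
  br_smul_left c x y := hf (by
    simp only [map_smul, hB, sbr_smul_left])
  br_smul_right c x y := hf (by
    simp only [map_smul, hB, sbr_smul_right])
  br_gr a b x hx y hy := by
    rw [Submodule.mem_comap, hB]
    exact sbr_gr hx hy
  br_skew a b x hx y hy := hf (by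
    simp only [map_smul, hB]
    exact sbr_skew hx hy)
  br_jacobi a b c x hx y hy z hz := hf (by
    simp only [map_smul, map_add, hB, map_zero]
    exact sbr_jacobi hx hy hz) }

theorem indInj_isHom {F : Type u} [Field F] {L : Type v} [AddCommGroup L] [Module F L]
    [LieSuper F L] {A : Type w} [AddCommGroup A] [Module F A] (f : A →ₗ[F] L)
    (hf : Injective f) (hb : ∀ x y : A, ∃ z : A, f z = sbr F (f x) (f y))
    (hg : ∀ x : A, ∃ x0 x1 : A, f x0 ∈ grd F L 0 ∧ f x1 ∈ grd F L 1 ∧ x = x0 + x1) :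
    letI := indInj f hf hb hg
    IsHom F f ∧ ∀ a x, f x ∈ grd F L a → x ∈ grd F A a := by
  letI := indInj f hf hb hg
  exact ⟨⟨fun a x hx => hx, fun x y => (hb x y).choose_spec⟩, fun a x hx => hx⟩

theorem extRel_of_inj {F : Type u} [Field F] {L : Type v} [AddCommGroup L] [Module F L]
    [LieSuper F L] {A : Type w} [AddCommGroup A] [Module F A] [LieSuper F A]
    {E : Type v} [AddCommGroup E] [Module F E] [LieSuper F E] (f : A →ₗ[F] E)
    (hf : Injective f) (hh : IsHom F f) (hgr : ∀ a x, f x ∈ grd F E a → x ∈ grd F A a)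
    (q : L → L → A) (hq : ExtRel F (fun x y => f (q x y))) : ExtRel F q where
  toTensor :=
    { add_left := fun m m' n => hf (by simpa using hq.toTensor.add_left m m' n)
      add_right := fun m m' n => hf (by simpa using hq.toTensor.add_right m m' n)
      smul_left := fun m m' n => hf (by simpa using hq.toTensor.smul_left m m' n)
      smul_right := fun m m' n => hf (by simpa using hq.toTensor.smul_right m m' n)
      grade := fun a b m hm n hn => hgr _ _ (hq.toTensor.grade a b m hm n hn)
      brk_left := fun a b m hm m' hm' n => hf (by
        simpa using hq.toTensor.brk_left a b m hm m' hm' n)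
      brk_right := fun a b c m hm n hn n' hn' => hf (by
        simpa using hq.toTensor.brk_right a b c m hm n hn n' hn')
      brk_brk := fun a b m hm n hn m' n' => hf (by
        rw [hh.2]
        simpa using hq.toTensor.brk_brk a b m hm n hn m' n') }
  alt := fun a b x hx y hy => hf (by simpa using hq.alt a b x hx y hy)
  alt_even := fun x hx => hf (by simpa using hq.alt_even x hx)

section ext
variable {F : Type u} [Field F] {L : Type v} [AddCommGroup L] [Module F L] [LieSuper F L]
  {E : Type v} [AddCommGroup E] [Module F E] [LieSuper F E] {t : L → L → E}

/-- The span of the generators. -/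
def spanT (F : Type u) [Field F] {L : Type v} {E : Type v} [AddCommGroup E] [Module F E]
    (t : L → L → E) : Submodule F E := Submodule.span F {e | ∃ x y, e = t x y}

theorem t_zero_left (hE : ExtRel F t) (x : L) : t 0 x = 0 := by
  simpa using hE.toTensor.smul_left 0 0 x

theorem t_zero_right (hE : ExtRel F t) (x : L) : t x 0 = 0 := by
  simpa using hE.toTensor.smul_right 0 x 0

theorem t_mem (x y : L) : t x y ∈ spanT F t := Submodule.subset_span ⟨x, y, rfl⟩

theorem t_brk (hE : ExtRel F t) (x y x' y' : L) :
    sbr F (t x y) (t x' y') = t (sbr F x y) (sbr F x' y') := by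
  have key : ∀ a b : ZMod 2, ∀ m ∈ grd F L a, ∀ n ∈ grd F L b,
      sbr F (t m n) (t x' y') = t (sbr F m n) (sbr F x' y') := by
    intro a b m hm n hn
    rw [hE.toTensor.brk_brk a b m hm n hn, sbr_skew hm hn, hE.toTensor.smul_left]
  obtain ⟨x0, hx0, x1, hx1, rfl⟩ := exists_dec F x
  obtain ⟨y0, hy0, y1, hy1, rfl⟩ := exists_dec F y
  simp only [hE.toTensor.add_left, hE.toTensor.add_right, sbr_add_left, sbr_add_right]
  rw [key _ _ _ hx0 _ hy0, key _ _ _ hx0 _ hy1, key _ _ _ hx1 _ hy0, key _ _ _ hx1 _ hy1]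
  abel

theorem spanT_brk (hE : ExtRel F t) (κ : E →ₗ[F] L) (hκt : ∀ x y : L, κ (t x y) = sbr F x y)
    {e e' : E} (he : e ∈ spanT F t) (he' : e' ∈ spanT F t) :
    sbr F e e' = t (κ e) (κ e') := by
  induction he using Submodule.span_induction with
  | zero => rw [sbr_zero_left, map_zero, t_zero_left hE]
  | add a b _ _ ha hb => rw [sbr_add_left, ha, hb, map_add, hE.toTensor.add_left]
  | smul c a _ ha => rw [sbr_smul_left, ha, map_smul, hE.toTensor.smul_left]
  | mem a ha =>
    obtain ⟨x, y, rfl⟩ := ha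
    induction he' using Submodule.span_induction with
    | zero => rw [sbr_zero_right, map_zero, t_zero_right hE]
    | add a b _ _ ha hb => rw [sbr_add_right, ha, hb, map_add, hE.toTensor.add_right]
    | smul c a _ ha => rw [sbr_smul_right, ha, map_smul, hE.toTensor.smul_right]
    | mem a ha =>
      obtain ⟨x', y', rfl⟩ := ha
      rw [t_brk hE, hκt, hκt]

theorem spanT_dec (hE : ExtRel F t) {e : E} (he : e ∈ spanT F t) :
    ∃ x0 ∈ spanT F t, ∃ x1 ∈ spanT F t, x0 ∈ grd F E 0 ∧ x1 ∈ grd F E 1 ∧ e = x0 + x1 := by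
  induction he using Submodule.span_induction with
  | zero => exact ⟨0, zero_mem _, 0, zero_mem _, zero_mem _, zero_mem _, by simp⟩
  | add a b _ _ ha hb =>
    obtain ⟨a0, h1, a1, h2, h3, h4, rfl⟩ := ha
    obtain ⟨b0, k1, b1, k2, k3, k4, rfl⟩ := hb
    exact ⟨a0 + b0, add_mem h1 k1, a1 + b1, add_mem h2 k2, add_mem h3 k3, add_mem h4 k4, by abel⟩
  | smul c a _ ha =>
    obtain ⟨a0, h1, a1, h2, h3, h4, rfl⟩ := ha
    exact ⟨c • a0, Submodule.smul_mem _ _ h1, c • a1, Submodule.smul_mem _ _ h2,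
      Submodule.smul_mem _ _ h3, Submodule.smul_mem _ _ h4, smul_add _ _ _⟩
  | mem a ha =>
    obtain ⟨x, y, rfl⟩ := ha
    obtain ⟨x0, hx0, x1, hx1, rfl⟩ := exists_dec F x
    obtain ⟨y0, hy0, y1, hy1, rfl⟩ := exists_dec F y
    refine ⟨t x0 y0 + t x1 y1, add_mem (t_mem _ _) (t_mem _ _), t x0 y1 + t x1 y0,
      add_mem (t_mem _ _) (t_mem _ _), add_mem ?_ ?_, add_mem ?_ ?_, ?_⟩
    · simpa using hE.toTensor.grade _ _ _ hx0 _ hy0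
    · simpa [zmod2_one_add_one] using hE.toTensor.grade _ _ _ hx1 _ hy1
    · simpa using hE.toTensor.grade _ _ _ hx0 _ hy1
    · simpa using hE.toTensor.grade _ _ _ hx1 _ hy0
    · simp only [hE.toTensor.add_left, hE.toTensor.add_right]; abel

theorem spanT_top (hE : IsExtObj F t) (κ : E →ₗ[F] L) (hκt : ∀ x y : L, κ (t x y) = sbr F x y) :
    spanT F t = ⊤ := by
  -- the subalgebra spanned by the generators, lifted
  let f1 : ULift.{max u v} (spanT F t) →ₗ[F] E :=
    (spanT F t).subtype ∘ₗ (ULift.moduleEquiv (R := F) (M := spanT F t)).toLinearMap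
  have hf1 : Injective f1 := (spanT F t).injective_subtype.comp (ULift.moduleEquiv).injective
  have hm1 : ∀ x, f1 x ∈ spanT F t := fun x => x.down.2
  have hb1 : ∀ x y, ∃ z, f1 z = sbr F (f1 x) (f1 y) := fun x y =>
    ⟨⟨⟨sbr F (f1 x) (f1 y), by
      rw [spanT_brk hE.rel κ hκt (hm1 x) (hm1 y)]; exact t_mem _ _⟩⟩, rfl⟩
  have hg1 : ∀ x, ∃ x0 x1, f1 x0 ∈ grd F E 0 ∧ f1 x1 ∈ grd F E 1 ∧ x = x0 + x1 := by
    intro x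
    obtain ⟨x0, h0, x1, h1, k0, k1, h⟩ := spanT_dec hE.rel (hm1 x)
    exact ⟨⟨⟨x0, h0⟩⟩, ⟨⟨x1, h1⟩⟩, k0, k1, hf1 h⟩
  letI i1 := indInj f1 hf1 hb1 hg1
  obtain ⟨hh1, hgr1⟩ := indInj_isHom f1 hf1 hb1 hg1
  let f2 : ULift.{max u v} E →ₗ[F] E := (ULift.moduleEquiv (R := F) (M := E)).toLinearMap
  have hf2 : Injective f2 := (ULift.moduleEquiv (R := F) (M := E)).injective
  have hb2 : ∀ x y, ∃ z, f2 z = sbr F (f2 x) (f2 y) := fun x y => ⟨⟨sbr F (f2 x) (f2 y)⟩, rfl⟩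
  have hg2 : ∀ x, ∃ x0 x1, f2 x0 ∈ grd F E 0 ∧ f2 x1 ∈ grd F E 1 ∧ x = x0 + x1 := by
    intro x
    obtain ⟨x0, h0, x1, h1, h⟩ := exists_dec F (f2 x)
    exact ⟨⟨x0⟩, ⟨x1⟩, h0, h1, hf2 h⟩
  letI i2 := indInj f2 hf2 hb2 hg2
  obtain ⟨hh2, hgr2⟩ := indInj_isHom f2 hf2 hb2 hg2
  let q1 : L → L → ULift.{max u v} (spanT F t) := fun x y => ⟨⟨t x y, t_mem x y⟩⟩
  let q2 : L → L → ULift.{max u v} E := fun x y => ⟨t x y⟩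
  have e1 : ExtRel F q1 := extRel_of_inj f1 hf1 hh1 hgr1 q1 hE.rel
  have e2 : ExtRel F q2 := extRel_of_inj f2 hf2 hh2 hgr2 q2 hE.rel
  obtain ⟨j, ⟨hj, hjt⟩, -⟩ := hE.lift ⟨ULift.{max u v} (spanT F t)⟩ q1 e1
  obtain ⟨k, -, hu⟩ := hE.lift ⟨ULift.{max u v} E⟩ q2 e2
  let up : E →ₗ[F] ULift.{max u v} E := (ULift.moduleEquiv (R := F) (M := E)).symm.toLinearMap
  have hup : ∀ e, f2 (up e) = e := fun e => rfl
  have k1 := hu up ⟨⟨fun a x hx => hgr2 _ _ hx, fun x y => hf2 (by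
    rw [hh2.2, hup, hup, hup])⟩, fun x y => rfl⟩
  have k2 := hu (up ∘ₗ f1 ∘ₗ j) ⟨⟨fun a x hx => hgr2 _ _ (hh1.1 _ _ (hj.1 _ _ hx)), fun x y => hf2 (by
    rw [hh2.2]
    simp only [LinearMap.comp_apply, hup]
    rw [hj.2]
    exact hh1.2 _ _)⟩, fun x y => by
      simp only [LinearMap.comp_apply]
      rw [hjt]; rfl⟩
  rw [eq_top_iff]
  rintro e -
  have : f2 (up e) = f2 ((up ∘ₗ f1 ∘ₗ j) e) := by rw [k2, ← k1]
  rw [hup] at this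
  rw [this]
  exact hm1 _

end ext

/-- Lie superalgebra structure on the quotient by a graded ideal. -/
@[reducible] noncomputable def indQuot {F : Type u} [Field F] {L : Type v} [AddCommGroup L] [Module F L]
    [LieSuper F L] (I : Submodule F L) (hI : IsGIdeal F I) :
    LieSuper F (L ⧸ I) :=
  let B : (L ⧸ I) → (L ⧸ I) → (L ⧸ I) := fun x y =>
    I.mkQ (sbr F (I.mkQ_surjective x).choose (I.mkQ_surjective y).choose)
  have hB : ∀ x y : L, B (I.mkQ x) (I.mkQ y) = I.mkQ (sbr F x y) := by
    intro x y
    have h1 := (I.mkQ_surjective (I.mkQ x)).choose_spec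
    have h2 := (I.mkQ_surjective (I.mkQ y)).choose_spec
    simp only [B]
    generalize (I.mkQ_surjective (I.mkQ x)).choose = x' at *
    generalize (I.mkQ_surjective (I.mkQ y)).choose = y' at *
    simp only [Submodule.mkQ_apply] at *
    rw [Submodule.Quotient.eq] at *
    have : sbr F x' y' - sbr F x y = sbr F (x' - x) y' + sbr F x (y' - y) := by
      rw [sbr_sub_left, sbr_sub_right]; abel
    rw [this]
    exact add_mem (hI.1 _ h1 _) (hI.2.1 _ _ h2)
  { gr := fun a => (grd F L a).map I.mkQ
    isCompl_gr := by
      constructor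
      · rw [disjoint_iff, eq_bot_iff]
        rintro x h
        obtain ⟨⟨x0, h0, rfl⟩, ⟨x1, h1, h⟩⟩ := Submodule.mem_inf.mp h
        simp only [Submodule.mkQ_apply] at h
        rw [Submodule.Quotient.eq] at h
        obtain ⟨y0, hy0, y1, hy1, h⟩ := hI.2.2 _ h
        have h' : (-x0) + x1 = y0 + y1 := by rw [← h]; abel
        have := (dec_unique (F := F) (neg_mem h0) h1 hy0.2 hy1.2 h').1
        have hx : x0 ∈ I := by
          have := this ▸ hy0.1
          simpa using this
        simpa using hx
      · rw [codisjoint_iff, eq_top_iff]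
        rintro x -
        obtain ⟨x, rfl⟩ := I.mkQ_surjective x
        obtain ⟨x0, h0, x1, h1, rfl⟩ := exists_dec F x
        exact Submodule.mem_sup.mpr ⟨_, ⟨x0, h0, rfl⟩, _, ⟨x1, h1, rfl⟩, (map_add _ _ _).symm⟩
    br := B
    br_add_left := by
      intro x y z
      obtain ⟨x, rfl⟩ := I.mkQ_surjective x
      obtain ⟨y, rfl⟩ := I.mkQ_surjective y
      obtain ⟨z, rfl⟩ := I.mkQ_surjective z
      rw [← map_add, hB, hB, hB, sbr_add_left, map_add]
    br_add_right := by
      intro x y z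
      obtain ⟨x, rfl⟩ := I.mkQ_surjective x
      obtain ⟨y, rfl⟩ := I.mkQ_surjective y
      obtain ⟨z, rfl⟩ := I.mkQ_surjective z
      rw [← map_add, hB, hB, hB, sbr_add_right, map_add]
    br_smul_left := by
      intro c x y
      obtain ⟨x, rfl⟩ := I.mkQ_surjective x
      obtain ⟨y, rfl⟩ := I.mkQ_surjective y
      rw [← map_smul, hB, hB, sbr_smul_left, map_smul]
    br_smul_right := by
      intro c x y
      obtain ⟨x, rfl⟩ := I.mkQ_surjective x
      obtain ⟨y, rfl⟩ := I.mkQ_surjective y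
      rw [← map_smul, hB, hB, sbr_smul_right, map_smul]
    br_gr := by
      rintro a b _ ⟨x, hx, rfl⟩ _ ⟨y, hy, rfl⟩
      rw [hB]
      exact ⟨_, sbr_gr hx hy, rfl⟩
    br_skew := by
      rintro a b _ ⟨x, hx, rfl⟩ _ ⟨y, hy, rfl⟩
      rw [hB, hB, ← map_smul, sbr_skew hx hy]
    br_jacobi := by
      rintro a b c _ ⟨x, hx, rfl⟩ _ ⟨y, hy, rfl⟩ _ ⟨z, hz, rfl⟩
      simp only [hB, ← map_smul, ← map_add]
      rw [sbr_jacobi hx hy hz, map_zero] }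

theorem indQuot_isHom {F : Type u} [Field F] {L : Type v} [AddCommGroup L] [Module F L]
    [LieSuper F L] (I : Submodule F L) (hI : IsGIdeal F I) :
    letI := indQuot I hI
    IsHom F I.mkQ := by
  letI := indQuot I hI
  refine ⟨fun a x hx => ⟨x, hx, rfl⟩, fun x y => ?_⟩
  have h1 := (I.mkQ_surjective (I.mkQ x)).choose_spec
  have h2 := (I.mkQ_surjective (I.mkQ y)).choose_spec
  change I.mkQ (sbr F x y) =
    I.mkQ (sbr F (I.mkQ_surjective (I.mkQ x)).choose (I.mkQ_surjective (I.mkQ y)).choose)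
  generalize (I.mkQ_surjective (I.mkQ x)).choose = x' at *
  generalize (I.mkQ_surjective (I.mkQ y)).choose = y' at *
  simp only [Submodule.mkQ_apply] at *
  symm
  rw [Submodule.Quotient.eq] at *
  have : sbr F x' y' - sbr F x y = sbr F (x' - x) y' + sbr F x (y' - y) := by
    rw [sbr_sub_left, sbr_sub_right]; abel
  rw [this]
  exact add_mem (hI.1 _ h1 _) (hI.2.1 _ _ h2)

section pres
variable {F : Type u} [Field F] {L : Type v} [AddCommGroup L] [Module F L] [LieSuper F L]
  {Fr : Type w} [AddCommGroup Fr] [Module F Fr] [LieSuper F Fr] {π : Fr →ₗ[F] L}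

theorem ker_dec (hπ : IsHom F π) {r : Fr} (hr : r ∈ LinearMap.ker π) :
    ∃ r0 ∈ LinearMap.ker π, ∃ r1 ∈ LinearMap.ker π,
      r0 ∈ grd F Fr 0 ∧ r1 ∈ grd F Fr 1 ∧ r = r0 + r1 := by
  obtain ⟨r0, h0, r1, h1, rfl⟩ := exists_dec F r
  have h : π r0 + π r1 = 0 + 0 := by
    rw [← map_add, LinearMap.mem_ker.mp hr, add_zero]
  have := dec_unique (F := F) (hπ.1 _ _ h0) (hπ.1 _ _ h1) (zero_mem _) (zero_mem _) h
  exact ⟨r0, this.1, r1, this.2, h0, h1, rfl⟩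

theorem lift_hom (hπ : IsHom F π) (hπs : Surjective π) {a : ZMod 2} {x : L}
    (hx : x ∈ grd F L a) : ∃ y ∈ grd F Fr a, π y = x := by
  obtain ⟨y, rfl⟩ := hπs x
  obtain ⟨y0, h0, y1, h1, rfl⟩ := exists_dec F y
  rcases zmod2_cases a with rfl | rfl
  · have := dec_unique (F := F) (hπ.1 _ _ h0) (hπ.1 _ _ h1) hx (zero_mem _) (by simp)
    exact ⟨y0, h0, this.1⟩
  · have := dec_unique (F := F) (hπ.1 _ _ h0) (hπ.1 _ _ h1) (zero_mem _) hx (by simp)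
    exact ⟨y1, h1, this.2⟩

theorem brk_mem (x y : Fr) (hx : x ∈ LinearMap.ker π) :
    sbr F x y ∈ bracketSpan F (LinearMap.ker π) ⊤ :=
  Submodule.subset_span ⟨x, hx, y, trivial, rfl⟩

theorem brk_mem' (hπ : IsHom F π) (x y : Fr) (hy : y ∈ LinearMap.ker π) :
    sbr F x y ∈ bracketSpan F (LinearMap.ker π) ⊤ := by
  obtain ⟨r0, k0, r1, k1, h0, h1, rfl⟩ := ker_dec hπ hy
  obtain ⟨x0, hx0, x1, hx1, rfl⟩ := exists_dec F x
  simp only [sbr_add_left, sbr_add_right]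
  rw [sbr_skew hx0 h0, sbr_skew hx0 h1, sbr_skew hx1 h0, sbr_skew hx1 h1]
  exact add_mem (add_mem (Submodule.smul_mem _ _ (brk_mem _ _ k0)) (Submodule.smul_mem _ _ (brk_mem _ _ k0)))
    (add_mem (Submodule.smul_mem _ _ (brk_mem _ _ k1)) (Submodule.smul_mem _ _ (brk_mem _ _ k1)))

theorem brk_le_ker (hπ : IsHom F π) : bracketSpan F (LinearMap.ker π) ⊤ ≤ LinearMap.ker π := by
  rw [bracketSpan, Submodule.span_le]
  rintro _ ⟨x, hx, y, -, rfl⟩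
  change π _ = 0
  rw [hπ.2, LinearMap.mem_ker.mp hx, sbr_zero_left]

theorem brk_ideal (hπ : IsHom F π) : IsGIdeal F (bracketSpan F (LinearMap.ker π) ⊤) := by
  refine ⟨fun x hx y => brk_mem _ _ (brk_le_ker hπ hx),
    fun y x hx => brk_mem' hπ _ _ (brk_le_ker hπ hx), fun x hx => ?_⟩
  induction hx using Submodule.span_induction with
  | zero => exact ⟨0, zero_mem _, 0, zero_mem _, by simp⟩
  | add a b _ _ ha hb =>
    obtain ⟨a0, h1, a1, h2, rfl⟩ := ha
    obtain ⟨b0, k1, b1, k2, rfl⟩ := hb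
    exact ⟨a0 + b0, add_mem h1 k1, a1 + b1, add_mem h2 k2, by abel⟩
  | smul c a _ ha =>
    obtain ⟨a0, h1, a1, h2, rfl⟩ := ha
    exact ⟨c • a0, Submodule.smul_mem _ _ h1, c • a1, Submodule.smul_mem _ _ h2, smul_add _ _ _⟩
  | mem a ha =>
    obtain ⟨x, hx, y, -, rfl⟩ := ha
    obtain ⟨r0, k0, r1, k1, h0, h1, rfl⟩ := ker_dec hπ hx
    obtain ⟨y0, hy0, y1, hy1, rfl⟩ := exists_dec F y
    refine ⟨sbr F r0 y0 + sbr F r1 y1, add_mem ⟨brk_mem _ _ k0, ?_⟩ ⟨brk_mem _ _ k1, ?_⟩,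
      sbr F r0 y1 + sbr F r1 y0, add_mem ⟨brk_mem _ _ k0, ?_⟩ ⟨brk_mem _ _ k1, ?_⟩, ?_⟩
    · simpa using sbr_gr h0 hy0
    · simpa [zmod2_one_add_one] using sbr_gr h1 hy1
    · simpa using sbr_gr h0 hy1
    · simpa using sbr_gr h1 hy0
    · simp only [sbr_add_left, sbr_add_right]; abel

/-- pushing the bracket down along `π`. -/
theorem extRel_push (h2 : (2 : F) ≠ 0) (hπ : IsHom F π) (hπs : Surjective π)
    {P : Type w} [AddCommGroup P] [Module F P] [LieSuper F P] (p : Fr →ₗ[F] P)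
    (hp : IsHom F p) (q : L → L → P) (hq : ∀ x y, q (π x) (π y) = p (sbr F x y)) :
    ExtRel F q := by
  have R := extRel_sbr (F := F) (L := Fr) h2
  refine ⟨⟨?_, ?_, ?_, ?_, ?_, ?_, ?_, ?_⟩, ?_, ?_⟩
  · intro x y z
    obtain ⟨x, rfl⟩ := hπs x
    obtain ⟨y, rfl⟩ := hπs y
    obtain ⟨z, rfl⟩ := hπs z
    rw [← map_add, hq, hq, hq, sbr_add_left, map_add]
  · intro x y z
    obtain ⟨x, rfl⟩ := hπs x
    obtain ⟨y, rfl⟩ := hπs y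
    obtain ⟨z, rfl⟩ := hπs z
    rw [← map_add, hq, hq, hq, sbr_add_right, map_add]
  · intro c x y
    obtain ⟨x, rfl⟩ := hπs x
    obtain ⟨y, rfl⟩ := hπs y
    rw [← map_smul, hq, hq, sbr_smul_left, map_smul]
  · intro c x y
    obtain ⟨x, rfl⟩ := hπs x
    obtain ⟨y, rfl⟩ := hπs y
    rw [← map_smul, hq, hq, sbr_smul_right, map_smul]
  · intro a b x hx y hy
    replace hx := lift_hom hπ hπs hx
    obtain ⟨x, hx, rfl⟩ := hx
    replace hy := lift_hom hπ hπs hy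
    obtain ⟨y, hy, rfl⟩ := hy
    rw [hq]
    exact hp.1 _ _ (sbr_gr hx hy)
  · intro a b x hx y hy z
    replace hx := lift_hom hπ hπs hx
    obtain ⟨x, hx, rfl⟩ := hx
    replace hy := lift_hom hπ hπs hy
    obtain ⟨y, hy, rfl⟩ := hy
    obtain ⟨z, rfl⟩ := hπs z
    simp only [← hπ.2, hq, ← map_smul, ← map_sub]
    rw [R.toTensor.brk_left a b x hx y hy z]
  · intro a b c x hx y hy z hz
    replace hx := lift_hom hπ hπs hx
    obtain ⟨x, hx, rfl⟩ := hx
    replace hy := lift_hom hπ hπs hy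
    obtain ⟨y, hy, rfl⟩ := hy
    replace hz := lift_hom hπ hπs hz
    obtain ⟨z, hz, rfl⟩ := hz
    simp only [← hπ.2, hq, ← map_smul, ← map_sub]
    rw [R.toTensor.brk_right a b c x hx y hy z hz]
  · intro a b x hx y hy z w
    replace hx := lift_hom hπ hπs hx
    obtain ⟨x, hx, rfl⟩ := hx
    replace hy := lift_hom hπ hπs hy
    obtain ⟨y, hy, rfl⟩ := hy
    obtain ⟨z, rfl⟩ := hπs z
    obtain ⟨w, rfl⟩ := hπs w
    simp only [← hπ.2, hq, ← hp.2, ← map_smul]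
    rw [R.toTensor.brk_brk a b x hx y hy z w]
  · intro a b x hx y hy
    replace hx := lift_hom hπ hπs hx
    obtain ⟨x, hx, rfl⟩ := hx
    replace hy := lift_hom hπ hπs hy
    obtain ⟨y, hy, rfl⟩ := hy
    rw [hq, hq, sbr_skew hx hy, map_smul]
  · intro x hx
    replace hx := lift_hom hπ hπs hx
    obtain ⟨x, hx, rfl⟩ := hx
    rw [hq, R.alt_even x hx, map_zero]

end pres

section cocycle
variable {F : Type u} [Field F] {L : Type v} [AddCommGroup L] [Module F L] [LieSuper F L]
  {Fr : Type w} [AddCommGroup Fr] [Module F Fr] [LieSuper F Fr] {π : Fr →ₗ[F] L}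
  {E : Type v} [AddCommGroup E] [Module F E] [LieSuper F E] {t : L → L → E}

theorem t_cocycle (hE : ExtRel F t) {a b c : ZMod 2} {x y z : L} (hx : x ∈ grd F L a)
    (hy : y ∈ grd F L b) (hz : z ∈ grd F L c) :
    sg F a c • t x (sbr F y z) + sg F b a • t y (sbr F z x) + sg F c b • t z (sbr F x y) = 0 := by
  rw [hE.alt _ _ z hz _ (sbr_gr hx hy), hE.toTensor.brk_left _ _ x hx y hy z, sbr_skew hz hx,
    hE.toTensor.smul_right]
  rcases zmod2_cases a with rfl | rfl <;> rcases zmod2_cases b with rfl | rfl <;>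
    rcases zmod2_cases c with rfl | rfl <;>
    simp only [sg_zero_left, sg_zero_right, sg_one_one, zmod2_one_add_one, add_zero, zero_add] <;>
    module

/-- The central extension of `Fr` by (the vector space) `E` given by the cocycle `t`. -/
@[reducible] def cocExt (hπ : IsHom F π) (hE : ExtRel F t) : LieSuper F (E × Fr) where
  gr a := (grd F E a).prod (grd F Fr a)
  isCompl_gr := (prodLieSuper F E Fr).isCompl_gr
  br x y := (t (π x.2) (π y.2), sbr F x.2 y.2)
  br_add_left x y z := by
    simp [hE.toTensor.add_left, sbr_add_left]
  br_add_right x y z := by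
    simp [hE.toTensor.add_right, sbr_add_right]
  br_smul_left c x y := by
    simp [hE.toTensor.smul_left, sbr_smul_left]
  br_smul_right c x y := by
    simp [hE.toTensor.smul_right, sbr_smul_right]
  br_gr a b x hx y hy :=
    ⟨hE.toTensor.grade a b _ (hπ.1 _ _ hx.2) _ (hπ.1 _ _ hy.2), sbr_gr hx.2 hy.2⟩
  br_skew a b x hx y hy :=
    Prod.ext (hE.alt a b _ (hπ.1 _ _ hx.2) _ (hπ.1 _ _ hy.2)) (sbr_skew hx.2 hy.2)
  br_jacobi a b c x hx y hy z hz := by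
    refine Prod.ext ?_ (sbr_jacobi hx.2 hy.2 hz.2)
    simp only [hπ.2]
    exact t_cocycle hE (hπ.1 _ _ hx.2) (hπ.1 _ _ hy.2) (hπ.1 _ _ hz.2)

end cocycle

theorem exists_phi {F : Type u} [Field F] {L : Type v} [AddCommGroup L] [Module F L] [LieSuper F L]
    {Fr : Type (max u v)} [AddCommGroup Fr] [Module F Fr] [LieSuper F Fr]
    (hfree : IsFreeLieSuper F Fr) {π : Fr →ₗ[F] L} (hπ : IsHom F π)
    {E : Type v} [AddCommGroup E] [Module F E] [LieSuper F E] {t : L → L → E}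
    (hE : ExtRel F t) : ∃ φ : Fr →ₗ[F] E, ∀ x y, φ (sbr F x y) = t (π x) (π y) := by
  obtain ⟨X, hX, hu⟩ := hfree
  obtain ⟨i, -, hi⟩ := hu ⟨Fr⟩ (fun a x => x) (fun a x => hX a x.2)
  obtain ⟨s, ⟨hs, hsx⟩, -⟩ := hu (@LieSupAlg.mk F _ (E × Fr) _ _ (cocExt hπ hE))
    (fun a x => ((0 : E), (x : Fr))) (fun a x => ⟨zero_mem _, hX a x.2⟩)
  have h1 := hi LinearMap.id ⟨⟨fun a x hx => hx, fun x y => rfl⟩, fun a x => rfl⟩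
  have h2 := hi (LinearMap.snd F E Fr ∘ₗ s) ⟨⟨fun a x hx => (hs.1 a x hx).2, fun x y =>
    congrArg Prod.snd (hs.2 x y)⟩, fun a x => congrArg Prod.snd (hsx a x)⟩
  have h3 : ∀ x, (s x).2 = x := fun x => by
    have := LinearMap.congr_fun (h2.trans h1.symm) x
    exact this
  refine ⟨LinearMap.fst F E Fr ∘ₗ s, fun x y => ?_⟩
  have := congrArg Prod.fst (hs.2 x y)
  refine this.trans ?_
  change t (π (s x).2) (π (s y).2) = _
  rw [h3, h3]

end Helpers

/-- the sequence `0 → M(L) → L ∧ L → L' → 0` is a central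
extension: the map `κ : L ∧ L → L`, `x ∧ y ↦ [x,y]`, has image `L'`, its kernel
is isomorphic to the Schur multiplier `M(L)` (computed from a free presentation
`0 → R → Fr →^π L → 0`), and its kernel is contained in the center of `L ∧ L`. -/
theorem schur_multiplier_exterior_central_extension (F : Type u) [Field F]
    (hchar2 : (2 : F) ≠ 0) (hchar3 : (3 : F) ≠ 0)
    (L : Type v) [AddCommGroup L] [Module F L] [LieSuper F L]
    -- a free presentation of `L`:
    (Fr : Type (max u v)) [AddCommGroup Fr] [Module F Fr] [LieSuper F Fr]
    (hfree : IsFreeLieSuper F Fr)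
    (π : Fr →ₗ[F] L) (hπ : IsHom F π) (hπs : Surjective π)
    -- the exterior square `L ∧ L`:
    (E : Type v) [AddCommGroup E] [Module F E] [LieSuper F E]
    (t : L → L → E) (hE : IsExtObj F t)
    -- the map `L ∧ L → L`, `x ∧ y ↦ [x,y]`:
    (κ : E →ₗ[F] L) (hκ : IsHom F κ) (hκt : ∀ x y : L, κ (t x y) = sbr F x y) :
    LinearMap.range κ = derived F L ∧
    LinearMap.ker κ ≤ centerS F E ∧
    Nonempty (↥(LinearMap.ker κ) ≃ₗ[F] SchurMul F Fr (LinearMap.ker π)) := by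
  have htop := spanT_top hE κ hκt
  obtain ⟨φ, hφ⟩ := exists_phi hfree hπ hE.rel
  have hmem : ∀ e : E, e ∈ spanT F t := fun e => htop ▸ Submodule.mem_top
  refine ⟨?_, ?_, ?_⟩
  · apply le_antisymm
    · rintro _ ⟨e, rfl⟩
      have he := hmem e
      induction he using Submodule.span_induction with
      | zero => rw [map_zero]; exact zero_mem _
      | add a b _ _ ha hb => rw [map_add]; exact add_mem ha hb
      | smul c a _ ha => rw [map_smul]; exact Submodule.smul_mem _ _ ha
      | mem a ha =>
        obtain ⟨x, y, rfl⟩ := ha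
        rw [hκt]
        exact Submodule.subset_span ⟨x, trivial, y, trivial, rfl⟩
    · rw [derived, bracketSpan, Submodule.span_le]
      rintro _ ⟨x, -, y, -, rfl⟩
      exact ⟨t x y, hκt x y⟩
  · intro e he x
    rw [spanT_brk hE.rel κ hκt (hmem e) (hmem x), LinearMap.mem_ker.mp he, t_zero_left hE.rel]
  · -- the map to the quotient
    set I := bracketSpan F (LinearMap.ker π) ⊤ with hIdef
    have hI : IsGIdeal F I := brk_ideal hπ
    letI := indQuot I hI
    have hmk : IsHom F I.mkQ := indQuot_isHom I hI
    let q : L → L → (Fr ⧸ I) := fun x y => I.mkQ (sbr F (hπs x).choose (hπs y).choose)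
    have hq : ∀ x y, q (π x) (π y) = I.mkQ (sbr F x y) := by
      intro x y
      have h1 := (hπs (π x)).choose_spec
      have h2 := (hπs (π y)).choose_spec
      simp only [q]
      generalize (hπs (π x)).choose = x' at *
      generalize (hπs (π y)).choose = y' at *
      simp only [Submodule.mkQ_apply]
      rw [Submodule.Quotient.eq]
      have : sbr F x' y' - sbr F x y = sbr F (x' - x) y' + sbr F x (y' - y) := by
        rw [sbr_sub_left, sbr_sub_right]; abel
      rw [this]
      exact add_mem (brk_mem _ _ (by simp [h1])) (brk_mem' hπ _ _ (by simp [h2]))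
    have hqE : ExtRel F q := extRel_push hchar2 hπ hπs I.mkQ hmk q hq
    obtain ⟨h, ⟨-, hht⟩, -⟩ := hE.lift ⟨Fr ⧸ I⟩ q hqE
    have hhφ : ∀ x ∈ derived F Fr, h (φ x) = I.mkQ x := by
      intro x hx
      induction hx using Submodule.span_induction with
      | zero => simp
      | add a b _ _ ha hb => rw [map_add, map_add, ha, hb, map_add]
      | smul c a _ ha => rw [map_smul, map_smul, ha, map_smul]
      | mem a ha =>
        obtain ⟨x, -, y, -, rfl⟩ := ha
        rw [hφ, hht, hq]
    have hκφ : ∀ x ∈ derived F Fr, κ (φ x) = π x := by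
      intro x hx
      induction hx using Submodule.span_induction with
      | zero => simp
      | add a b _ _ ha hb => rw [map_add, map_add, ha, hb, map_add]
      | smul c a _ ha => rw [map_smul, map_smul, ha, map_smul]
      | mem a ha =>
        obtain ⟨x, -, y, -, rfl⟩ := ha
        rw [hφ, hκt, hπ.2]
    have hφI : ∀ x ∈ I, φ x = 0 := by
      intro x hx
      induction hx using Submodule.span_induction with
      | zero => simp
      | add a b _ _ ha hb => rw [map_add, ha, hb, add_zero]
      | smul c a _ ha => rw [map_smul, ha, smul_zero]
      | mem a ha =>
        obtain ⟨x, hx, y, -, rfl⟩ := ha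
        rw [hφ, LinearMap.mem_ker.mp hx, t_zero_left hE.rel]
    have hsurj : ∀ e : E, ∃ x ∈ derived F Fr, φ x = e := by
      intro e
      have he := hmem e
      induction he using Submodule.span_induction with
      | zero => exact ⟨0, zero_mem _, map_zero _⟩
      | add a b _ _ ha hb =>
        obtain ⟨x, hx, rfl⟩ := ha
        obtain ⟨y, hy, rfl⟩ := hb
        exact ⟨x + y, add_mem hx hy, map_add _ _ _⟩
      | smul c a _ ha =>
        obtain ⟨x, hx, rfl⟩ := ha
        exact ⟨c • x, Submodule.smul_mem _ _ hx, map_smul _ _ _⟩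
      | mem a ha =>
        obtain ⟨x, y, rfl⟩ := ha
        obtain ⟨x, rfl⟩ := hπs x
        obtain ⟨y, rfl⟩ := hπs y
        exact ⟨sbr F x y, Submodule.subset_span ⟨x, trivial, y, trivial, rfl⟩, hφ x y⟩
    let ψ : ↥(schurA F Fr (LinearMap.ker π)) →ₗ[F] ↥(LinearMap.ker κ) :=
      (φ ∘ₗ (schurA F Fr (LinearMap.ker π)).subtype).codRestrict _ (fun x => by
        rw [LinearMap.mem_ker]
        exact (hκφ _ x.2.1).trans x.2.2)
    have hψ : ∀ x, (ψ x : E) = φ x := fun x => rfl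
    have hψs : Surjective ψ := by
      rintro ⟨e, he⟩
      obtain ⟨x, hx, rfl⟩ := hsurj e
      refine ⟨⟨x, hx, ?_⟩, Subtype.ext rfl⟩
      exact (hκφ x hx).symm.trans he
    have hker : LinearMap.ker ψ = Submodule.comap (schurA F Fr (LinearMap.ker π)).subtype I := by
      ext x
      rw [LinearMap.mem_ker, Submodule.mem_comap]
      constructor
      · intro hx
        have h0 : φ x = 0 := by rw [← hψ, hx]; rfl
        have := hhφ _ x.2.1
        rw [h0, map_zero] at this
        simpa using this.symm
      · intro hx
        exact Subtype.ext (hφI _ hx)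
    exact ⟨((Submodule.quotEquivOfEq _ _ hker.symm).trans
      (ψ.quotKerEquivOfSurjective hψs)).symm⟩

end SuperLie
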